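/- Let p₀ be a twice continuously differentiable probability density on ℝ^d with ∫(‖∇p₀‖/p₀)⁴ p₀ dλ < ∞ and ∫(‖∇²p₀‖₂/p₀)² p₀ dλ < ∞, where ‖A‖₂ is the spectral norm. Let p_σ(x) = ∫p₀(x - σy)φ(y)dy be the convolution of p₀ with the standard d-variate Gaussian scaled by σ. Then the Hellinger distance satisfies h(p₀, p_σ) ≤ C σ² for a constant C depending only on p₀ and d. -/

import Mathlib

open MeasureTheory Real

/-- The standard `N(0, I_d)` density on `ℝ^d`. -/
noncomputable def stdGauss (d : ℕ) (y : EuclideanSpace ℝ (Fin d)) : ℝ :=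
  (2 * π) ^ (-(d : ℝ) / 2) * Real.exp (-‖y‖ ^ 2 / 2)


lemma sg_nonneg (d : ℕ) (y : EuclideanSpace ℝ (Fin d)) : 0 ≤ stdGauss d y := by
  unfold stdGauss; positivity

lemma sg_cont (d : ℕ) : Continuous (stdGauss d) := by
  unfold stdGauss; fun_prop

lemma sg_int_exp (d : ℕ) {b : ℝ} (hb : 0 < b) :
    Integrable (fun y : EuclideanSpace ℝ (Fin d) => Real.exp (-b * ‖y‖ ^ 2)) := by
  by_contra h
  have h1 := GaussianFourier.integral_rexp_neg_mul_sq_norm (V := EuclideanSpace ℝ (Fin d)) hb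
  rw [integral_undef h] at h1
  have : 0 < (π / b) ^ ((Module.finrank ℝ (EuclideanSpace ℝ (Fin d)) : ℝ) / 2) := by positivity
  linarith

lemma sg_eq (d : ℕ) : stdGauss d = fun y =>
    (2 * π) ^ (-(d : ℝ) / 2) * Real.exp (-(1/2) * ‖y‖ ^ 2) := by
  funext y; unfold stdGauss; congr 2; ring

lemma sg_int (d : ℕ) : Integrable (stdGauss d) := by
  rw [sg_eq]; exact (sg_int_exp d (by norm_num)).const_mul _

lemma sg_one (d : ℕ) : ∫ y, stdGauss d y = 1 := by
  rw [sg_eq, integral_const_mul, GaussianFourier.integral_rexp_neg_mul_sq_norm (by norm_num)]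
  rw [finrank_euclideanSpace_fin, show π / (1/2) = 2 * π by ring, ← Real.rpow_add (by positivity)]
  rw [show -(d : ℝ) / 2 + d / 2 = 0 by ring, Real.rpow_zero]

lemma sg_norm_int (d : ℕ) : Integrable (fun y => ‖y‖ * stdGauss d y) := by
  have h := (sg_int_exp d (b := 1/4) (by norm_num)).const_mul ((2 * π) ^ (-(d : ℝ) / 2))
  refine h.mono' ((continuous_norm.mul (sg_cont d)).aestronglyMeasurable) (ae_of_all _ fun y => ?_)
  rw [Real.norm_of_nonneg (mul_nonneg (norm_nonneg _) (sg_nonneg d y)), sg_eq]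
  have h1 : ‖y‖ ≤ Real.exp (1/4 * ‖y‖^2) := by
    have := Real.add_one_le_exp (1/4 * ‖y‖^2)
    nlinarith [sq_nonneg (‖y‖/2 - 1)]
  have h2 : Real.exp (-(1/4) * ‖y‖^2) = Real.exp (1/4 * ‖y‖^2) * Real.exp (-(1/2) * ‖y‖^2) := by
    rw [← Real.exp_add]; congr 1; ring
  simp only []
  rw [h2]
  have : 0 ≤ (2 * π) ^ (-(d : ℝ) / 2) * Real.exp (-(1/2) * ‖y‖^2) := by positivity
  nlinarith [mul_le_mul_of_nonneg_right h1 this]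

lemma sg_fderiv (d : ℕ) (y : EuclideanSpace ℝ (Fin d)) :
    HasFDerivAt (stdGauss d) (-(stdGauss d y) • innerSL ℝ y) y := by
  have h1 : HasFDerivAt (fun y : EuclideanSpace ℝ (Fin d) => ‖y‖ ^ 2) (2 • innerSL ℝ y) y :=
    (hasStrictFDerivAt_norm_sq y).hasFDerivAt
  have h2 := ((h1.const_mul (-(1/2) : ℝ)).exp).const_mul ((2 * π) ^ (-(d : ℝ) / 2))
  rw [sg_eq]
  refine h2.congr_fderiv ?_
  ext v
  simp
  ring

lemma sg_bdd (d : ℕ) (y : EuclideanSpace ℝ (Fin d)) : ‖stdGauss d y‖ ≤ (2 * π) ^ (-(d : ℝ) / 2) := by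
  rw [Real.norm_of_nonneg (sg_nonneg d y), stdGauss]
  have : Real.exp (-‖y‖^2/2) ≤ 1 := Real.exp_le_one_iff.2 (by nlinarith [sq_nonneg ‖y‖])
  have h : 0 ≤ (2 * π) ^ (-(d : ℝ) / 2) := by positivity
  nlinarith

lemma int_comp (d : ℕ) {f : (EuclideanSpace ℝ (Fin d)) → ℝ} (hf : Integrable f) (x : EuclideanSpace ℝ (Fin d)) {r : ℝ} (hr : r ≠ 0) :
    Integrable (fun y => f (x - r • y)) :=
  (hf.comp_sub_left x).comp_smul hr

lemma int_comp_sg (d : ℕ) {f : (EuclideanSpace ℝ (Fin d)) → ℝ} (hf : Integrable f) (x : EuclideanSpace ℝ (Fin d)) {r : ℝ} (hr : r ≠ 0) :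
    Integrable (fun y => f (x - r • y) * stdGauss d y) :=
  (int_comp d hf x hr).mul_bdd (c := (2 * π) ^ (-(d : ℝ) / 2)) (sg_cont d).aestronglyMeasurable
    (ae_of_all _ (sg_bdd d))

lemma ae_comp (d : ℕ) {P : (EuclideanSpace ℝ (Fin d)) → Prop} (hP : ∀ᵐ x, P x) (x : EuclideanSpace ℝ (Fin d)) {r : ℝ} (hr : r ≠ 0) :
    ∀ᵐ y, P (x - r • y) := by
  have h1 := (quasiMeasurePreserving_sub_left (volume : Measure (EuclideanSpace ℝ (Fin d))) x).ae hP
  exact (Measure.quasiMeasurePreserving_smul (volume : Measure (EuclideanSpace ℝ (Fin d))) hr).ae h1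

/-- Hessian vanishes a.e. on the zero set. -/
lemma hess_zero (d : ℕ) (p : (EuclideanSpace ℝ (Fin d)) → ℝ) (hs : ContDiff ℝ 2 p) (hp : ∀ x, 0 ≤ p x) :
    ∀ᵐ x, p x = 0 → fderiv ℝ (fderiv ℝ p) x = 0 := by
  let L : StrongDual ℝ (EuclideanSpace ℝ (Fin d)) →L[ℝ] (EuclideanSpace ℝ (Fin d)) :=
    LinearMap.toContinuousLinearMap
      { toFun := fun v => (InnerProductSpace.toDual ℝ (EuclideanSpace ℝ (Fin d))).symm v
        map_add' := fun v w => map_add _ v w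
        map_smul' := fun c v => by simp }
  have hLn : ∀ v, ‖L v‖ = ‖v‖ := fun v => (InnerProductSpace.toDual ℝ (EuclideanSpace ℝ (Fin d))).symm.norm_map v
  have hmeas : MeasurableSet {x | p x = 0} :=
    (isClosed_eq hs.continuous continuous_const).measurableSet
  have hd : ∀ x, DifferentiableAt ℝ (fderiv ℝ p) x := fun x =>
    ((hs.fderiv_right (m := 1) (by norm_num)).differentiable (by norm_num)) x
  have hg : ∀ x, p x = 0 → fderiv ℝ p x = 0 := fun x hx =>
    IsLocalMin.fderiv_eq_zero (Filter.Eventually.of_forall fun z => by rw [hx]; exact hp z)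
  have happ : ApproximatesLinearOn (fun x => L (fderiv ℝ p x)) (0 : (EuclideanSpace ℝ (Fin d)) →L[ℝ] (EuclideanSpace ℝ (Fin d)))
      {x | p x = 0} 0 := by
    intro x hx y hy
    simp [hg x hx, hg y hy]
  have := happ.norm_fderiv_sub_le volume hmeas (fun x => L.comp (fderiv ℝ (fderiv ℝ p) x))
    (fun x _ => (L.hasFDerivAt.comp x (hd x).hasFDerivAt).hasFDerivWithinAt)
  rw [ae_restrict_iff' hmeas] at this
  filter_upwards [this] with x hx h0
  have h1 := hx h0
  simp only [sub_zero, nonpos_iff_eq_zero, nnnorm_eq_zero] at h1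
  ext v w
  have h2 : L (fderiv ℝ (fderiv ℝ p) x v) = 0 := by
    have := congrArg (fun A => A v) h1
    simpa using this
  have h3 : fderiv ℝ (fderiv ℝ p) x v = 0 := by
    rw [← norm_eq_zero, ← hLn, h2, norm_zero]
  simp [h3]

lemma G_int (d : ℕ) (p : (EuclideanSpace ℝ (Fin d)) → ℝ) (hs : ContDiff ℝ 2 p) (B : ℝ)
    (hB : ∀ x, ‖p x‖ ≤ B) (x : EuclideanSpace ℝ (Fin d)) (r : ℝ) :
    Integrable (fun y => p (x - r • y) * stdGauss d y) := by
  have hc : Continuous (fun y : EuclideanSpace ℝ (Fin d) => p (x - r • y)) := hs.continuous.comp (by fun_prop)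
  exact (sg_int d).bdd_mul (c := B) hc.aestronglyMeasurable (ae_of_all _ fun y => hB _)

lemma G_deriv (d : ℕ) (p : (EuclideanSpace ℝ (Fin d)) → ℝ) (hs : ContDiff ℝ 2 p) (B : ℝ)
    (hB0 : ∀ x, ‖p x‖ ≤ B) (hB : ∀ x, ‖fderiv ℝ p x‖ ≤ B) (x : EuclideanSpace ℝ (Fin d)) (r : ℝ) :
    HasDerivAt (fun r : ℝ => ∫ y, p (x - r • y) * stdGauss d y)
      (∫ y, -(fderiv ℝ p (x - r • y) y) * stdGauss d y) r := by
  have hdc : Continuous (fderiv ℝ p) := hs.continuous_fderiv (by norm_num)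
  refine (hasDerivAt_integral_of_dominated_loc_of_deriv_le (𝕜 := ℝ) (s := Set.univ)
    (F := fun r y => p (x - r • y) * stdGauss d y)
    (F' := fun r y => -(fderiv ℝ p (x - r • y) y) * stdGauss d y)
    (bound := fun y => B * (‖y‖ * stdGauss d y)) Filter.univ_mem ?_ ?_ ?_ ?_ ?_ ?_).2
  · exact Filter.Eventually.of_forall fun r => (G_int d p hs B hB0 x r).aestronglyMeasurable
  · exact G_int d p hs B hB0 x r
  · have h1 : Continuous (fun y : EuclideanSpace ℝ (Fin d) => fderiv ℝ p (x - r • y) y) :=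
      (hdc.comp (by fun_prop)).clm_apply continuous_id
    exact (h1.neg.mul (sg_cont d)).aestronglyMeasurable
  · refine ae_of_all _ fun y r _ => ?_
    rw [norm_mul, norm_neg, Real.norm_of_nonneg (sg_nonneg d y), ← mul_assoc]
    refine mul_le_mul_of_nonneg_right ?_ (sg_nonneg d y)
    exact ((fderiv ℝ p (x - r • y)).le_opNorm y).trans
      (mul_le_mul_of_nonneg_right (hB _) (norm_nonneg _))
  · exact (sg_norm_int d).const_mul B
  · refine ae_of_all _ fun y r _ => ?_
    have h1 : HasDerivAt (fun r : ℝ => x - r • y) (-y) r := by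
      simpa using ((hasDerivAt_id r).smul_const y).const_sub x
    have h2 := ((hs.differentiable (by norm_num)) (x - r • y)).hasFDerivAt.comp_hasDerivAt r h1
    have h3 := h2.mul_const (stdGauss d y)
    rw [map_neg] at h3
    exact h3

lemma G'_cont (d : ℕ) (p : (EuclideanSpace ℝ (Fin d)) → ℝ) (hs : ContDiff ℝ 2 p) (B : ℝ)
    (hB : ∀ x, ‖fderiv ℝ p x‖ ≤ B) (x : EuclideanSpace ℝ (Fin d)) :
    Continuous (fun r : ℝ => ∫ y, -(fderiv ℝ p (x - r • y) y) * stdGauss d y) := by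
  have hdc : Continuous (fderiv ℝ p) := hs.continuous_fderiv (by norm_num)
  refine continuous_of_dominated (bound := fun y => B * (‖y‖ * stdGauss d y)) ?_ ?_ ?_ ?_
  · intro r
    have h1 : Continuous (fun y : EuclideanSpace ℝ (Fin d) => fderiv ℝ p (x - r • y) y) :=
      (hdc.comp (by fun_prop)).clm_apply continuous_id
    exact (h1.neg.mul (sg_cont d)).aestronglyMeasurable
  · refine fun r => ae_of_all _ fun y => ?_
    rw [norm_mul, norm_neg, Real.norm_of_nonneg (sg_nonneg d y), ← mul_assoc]
    refine mul_le_mul_of_nonneg_right ?_ (sg_nonneg d y)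
    exact ((fderiv ℝ p (x - r • y)).le_opNorm y).trans
      (mul_le_mul_of_nonneg_right (hB _) (norm_nonneg _))
  · exact (sg_norm_int d).const_mul B
  · refine ae_of_all _ fun y => ?_
    have h1 : Continuous (fun r : ℝ => fderiv ℝ p (x - r • y) y) :=
      (hdc.comp (by fun_prop)).clm_apply continuous_const
    exact h1.neg.mul continuous_const

lemma ibp_i (d : ℕ) (p : (EuclideanSpace ℝ (Fin d)) → ℝ) (hs : ContDiff ℝ 2 p) (B : ℝ)
    (hB : ∀ x, ‖fderiv ℝ p x‖ ≤ B) (hH : Integrable (fun x => ‖fderiv ℝ (fderiv ℝ p) x‖))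
    (x : EuclideanSpace ℝ (Fin d)) {r : ℝ} (hr : r ≠ 0) (e : EuclideanSpace ℝ (Fin d)) (he : ‖e‖ = 1) :
    Integrable (fun y => (fderiv ℝ p (x - r • y) e * inner ℝ y e) * stdGauss d y) ∧
    |∫ y, (fderiv ℝ p (x - r • y) e * inner ℝ y e) * stdGauss d y| ≤
      |r| * ∫ y, ‖fderiv ℝ (fderiv ℝ p) (x - r • y)‖ * stdGauss d y := by
  have hdc : Continuous (fderiv ℝ p) := hs.continuous_fderiv (by norm_num)
  have hd1 : ContDiff ℝ 1 (fderiv ℝ p) := hs.fderiv_right (m := 1) (by norm_num)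
  have hd : ∀ x, DifferentiableAt ℝ (fderiv ℝ p) x := fun x =>
    (hd1.differentiable (by norm_num)) x
  have hddc : Continuous (fderiv ℝ (fderiv ℝ p)) := hd1.continuous_fderiv (by norm_num)
  let f : (EuclideanSpace ℝ (Fin d)) → ℝ := fun y => fderiv ℝ p (x - r • y) e
  have hfc : Continuous f := (hdc.comp (by fun_prop)).clm_apply continuous_const
  have hfB : ∀ y, ‖f y‖ ≤ B := fun y => by
    have := (fderiv ℝ p (x - r • y)).le_opNorm e
    rw [he, mul_one] at this
    exact this.trans (hB _)
  have hf' : ∀ y, HasFDerivAt f (((ContinuousLinearMap.apply ℝ ℝ e).comp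
      (fderiv ℝ (fderiv ℝ p) (x - r • y))).comp (-(r • ContinuousLinearMap.id ℝ (EuclideanSpace ℝ (Fin d))))) y := by
    intro y
    have h1 : HasFDerivAt (fun y : EuclideanSpace ℝ (Fin d) => x - r • y) (-(r • ContinuousLinearMap.id ℝ (EuclideanSpace ℝ (Fin d)))) y :=
      ((hasFDerivAt_id y).const_smul r).const_sub x
    have h2 : HasFDerivAt (fun z => fderiv ℝ p z e) ((ContinuousLinearMap.apply ℝ ℝ e).comp
      (fderiv ℝ (fderiv ℝ p) (x - r • y))) (x - r • y) :=
      (ContinuousLinearMap.apply ℝ ℝ e).hasFDerivAt.comp _ (hd _).hasFDerivAt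
    exact h2.comp y h1
  have hfe : ∀ y, fderiv ℝ f y e = -r * fderiv ℝ (fderiv ℝ p) (x - r • y) e e := fun y => by
    rw [(hf' y).fderiv]; simp
  have hge : ∀ y, fderiv ℝ (stdGauss d) y e = - (inner ℝ y e * stdGauss d y) := fun y => by
    rw [(sg_fderiv d y).fderiv]; simp [mul_comm]
  have hHi := int_comp_sg d hH x hr
  have hle : ∀ y, |fderiv ℝ f y e * stdGauss d y| ≤
      |r| * (‖fderiv ℝ (fderiv ℝ p) (x - r • y)‖ * stdGauss d y) := fun y => by
    rw [hfe, abs_mul, abs_mul, abs_neg, abs_of_nonneg (sg_nonneg d y), ← mul_assoc]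
    refine mul_le_mul_of_nonneg_right (mul_le_mul_of_nonneg_left ?_ (abs_nonneg _)) (sg_nonneg d y)
    have := (fderiv ℝ (fderiv ℝ p) (x - r • y)).le_opNorm₂ e e
    simpa [he] using this
  have i1 : Integrable (fun y => fderiv ℝ f y e * stdGauss d y) := by
    refine (hHi.const_mul |r|).mono' ?_ (ae_of_all _ hle)
    have : Continuous (fun y => fderiv ℝ f y e) := by
      simp_rw [hfe]
      have : Continuous (fun y : EuclideanSpace ℝ (Fin d) => fderiv ℝ (fderiv ℝ p) (x - r • y)) :=
        hddc.comp (by fun_prop)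
      exact continuous_const.mul ((this.clm_apply continuous_const).clm_apply continuous_const)
    exact (this.mul (sg_cont d)).aestronglyMeasurable
  have i2' : Integrable (fun y => inner ℝ y e * stdGauss d y) := by
    refine (sg_norm_int d).mono' ?_ (ae_of_all _ fun y => ?_)
    · exact ((continuous_id.inner continuous_const).mul (sg_cont d)).aestronglyMeasurable
    · rw [norm_mul, Real.norm_of_nonneg (sg_nonneg d y)]
      refine mul_le_mul_of_nonneg_right ?_ (sg_nonneg d y)
      simpa [he] using norm_inner_le_norm (𝕜 := ℝ) y e
  have i3 : Integrable (fun y => f y * (inner ℝ y e * stdGauss d y)) :=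
    i2'.bdd_mul (c := B) hfc.aestronglyMeasurable (ae_of_all _ hfB)
  have i2 : Integrable (fun y => f y * fderiv ℝ (stdGauss d) y e) := by
    simp_rw [hge, mul_neg]; exact i3.neg
  have i4 : Integrable (fun y => f y * stdGauss d y) :=
    (sg_int d).bdd_mul (c := B) hfc.aestronglyMeasurable (ae_of_all _ hfB)
  have key := integral_mul_fderiv_eq_neg_fderiv_mul_of_integrable i1 i2 i4
    (fun y _ => (hf' y).differentiableAt) (fun y _ => (sg_fderiv d y).differentiableAt)
  simp_rw [hge, mul_neg, integral_neg, neg_inj, ← mul_assoc] at key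
  simp_rw [← mul_assoc] at i3
  refine ⟨i3, ?_⟩
  change |∫ y, f y * inner ℝ y e * stdGauss d y| ≤ _
  rw [key, ← integral_const_mul]
  exact (abs_integral_le_integral_abs).trans (integral_mono i1.abs (hHi.const_mul _) hle)

lemma G'_bound (d : ℕ) (p : (EuclideanSpace ℝ (Fin d)) → ℝ) (hs : ContDiff ℝ 2 p) (B : ℝ)
    (hB : ∀ x, ‖fderiv ℝ p x‖ ≤ B) (hH : Integrable (fun x => ‖fderiv ℝ (fderiv ℝ p) x‖))
    (x : EuclideanSpace ℝ (Fin d)) {r : ℝ} (hr : r ≠ 0) :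
    |∫ y, -(fderiv ℝ p (x - r • y) y) * stdGauss d y| ≤
      d * (|r| * ∫ y, ‖fderiv ℝ (fderiv ℝ p) (x - r • y)‖ * stdGauss d y) := by
  let b := EuclideanSpace.basisFun (Fin d) ℝ
  have hb := fun i => ibp_i d p hs B hB hH x hr (b i) (b.orthonormal.1 i)
  have h1 : ∀ y, -(fderiv ℝ p (x - r • y) y) * stdGauss d y =
      - ∑ i, (fderiv ℝ p (x - r • y) (b i) * inner ℝ y (b i)) * stdGauss d y := fun y => by
    have h2 : fderiv ℝ p (x - r • y) y = ∑ i, fderiv ℝ p (x - r • y) (b i) * inner ℝ y (b i) := by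
      generalize fderiv ℝ p (x - r • y) = A
      conv_lhs => rw [← b.sum_repr' y]
      rw [map_sum]
      refine Finset.sum_congr rfl fun i _ => ?_
      rw [map_smul, smul_eq_mul, mul_comm, real_inner_comm]
    rw [h2, ← Finset.sum_mul, neg_mul]
  simp_rw [h1]
  rw [integral_neg, abs_neg, integral_finsetSum _ (fun i _ => (hb i).1)]
  refine (Finset.abs_sum_le_sum_abs _ _).trans ?_
  refine (Finset.sum_le_sum fun i _ => (hb i).2).trans ?_
  simp

lemma cs (d : ℕ) (p H K : (EuclideanSpace ℝ (Fin d)) → ℝ) (x : EuclideanSpace ℝ (Fin d)) {r : ℝ} (hr : r ≠ 0)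
    (hp : Integrable p) (hH : Integrable H) (hK : Integrable K) (hp0 : ∀ x, 0 ≤ p x)
    (hK0 : ∀ x, 0 ≤ K x)
    (h : ∀ᵐ x, H x ^ 2 ≤ K x * p x) :
    (∫ y, H (x - r • y) * stdGauss d y) ^ 2 ≤
      (∫ y, K (x - r • y) * stdGauss d y) * ∫ y, p (x - r • y) * stdGauss d y := by
  have ip := int_comp_sg d hp x hr
  have iH := int_comp_sg d hH x hr
  have iK := int_comp_sg d hK x hr
  have := discrim_le_zero (a := ∫ y, p (x - r • y) * stdGauss d y)
    (b := 2 * ∫ y, H (x - r • y) * stdGauss d y) (c := ∫ y, K (x - r • y) * stdGauss d y) (by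
      intro l
      have e : (∫ y, p (x - r • y) * stdGauss d y) * (l * l) +
          2 * (∫ y, H (x - r • y) * stdGauss d y) * l + ∫ y, K (x - r • y) * stdGauss d y =
          ∫ y, ((l * l) * (p (x - r • y) * stdGauss d y) +
            (2 * l) * (H (x - r • y) * stdGauss d y)) + K (x - r • y) * stdGauss d y := by
        have i1 : Integrable (fun y => (l * l) * (p (x - r • y) * stdGauss d y) +
            (2 * l) * (H (x - r • y) * stdGauss d y)) := (ip.const_mul _).add (iH.const_mul _)
        rw [integral_add i1 iK,
          integral_add (ip.const_mul _) (iH.const_mul _), integral_const_mul, integral_const_mul]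
        ring
      rw [e]
      refine integral_nonneg_of_ae ?_
      filter_upwards [ae_comp d h x hr] with y hy
      have h1 : 0 ≤ l * l * p (x - r • y) + 2 * l * H (x - r • y) + K (x - r • y) := by
        have hp := hp0 (x - r • y)
        have hk := hK0 (x - r • y)
        generalize p (x - r • y) = P at *
        generalize H (x - r • y) = Q at *
        generalize K (x - r • y) = R at *
        rcases hp.eq_or_lt with h0 | h0
        · have : Q = 0 := by
            have : Q ^ 2 ≤ 0 := by rw [← h0] at hy; simpa using hy
            exact pow_eq_zero_iff (two_ne_zero) |>.1 (le_antisymm this (sq_nonneg _))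
          rw [← h0, this]; simpa using hk
        · by_contra hc
          push Not at hc
          nlinarith [mul_neg_of_pos_of_neg h0 hc, sq_nonneg (l * P + Q)]
      have := mul_nonneg h1 (sg_nonneg d y)
      simp only [Pi.zero_apply]
      nlinarith [this])
  unfold discrim at this
  nlinarith

lemma jensen {f : ℝ → ℝ} (hf : Continuous f) {s : ℝ} (hs : 0 < s) :
    (∫ r in (0:ℝ)..s, f r) ^ 2 ≤ s * ∫ r in (0:ℝ)..s, f r ^ 2 := by
  have := discrim_le_zero (a := s) (b := 2 * ∫ r in (0:ℝ)..s, f r)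
    (c := ∫ r in (0:ℝ)..s, f r ^ 2) (by
      intro l
      have e : s * (l * l) + (2 * ∫ r in (0:ℝ)..s, f r) * l + ∫ r in (0:ℝ)..s, f r ^ 2 =
          ∫ r in (0:ℝ)..s, (l * l + (2 * l) * f r) + f r ^ 2 := by
        rw [intervalIntegral.integral_add, intervalIntegral.integral_add,
          intervalIntegral.integral_const_mul, intervalIntegral.integral_const]
        · simp; ring
        all_goals exact Continuous.intervalIntegrable (by fun_prop) _ _
      rw [e]
      refine intervalIntegral.integral_nonneg hs.le fun r _ => ?_
      nlinarith [sq_nonneg (l + f r)])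
  unfold discrim at this
  nlinarith

lemma pointwise (d : ℕ) (p K : (EuclideanSpace ℝ (Fin d)) → ℝ) (hs : ContDiff ℝ 2 p) (B : ℝ)
    (hB0 : ∀ x, ‖p x‖ ≤ B) (hB : ∀ x, ‖fderiv ℝ p x‖ ≤ B)
    (hH : Integrable (fun x => ‖fderiv ℝ (fderiv ℝ p) x‖))
    (hp : Integrable p) (hK : Integrable K) (hp0 : ∀ x, 0 ≤ p x) (hK0 : ∀ x, 0 ≤ K x)
    (h : ∀ᵐ x, ‖fderiv ℝ (fderiv ℝ p) x‖ ^ 2 ≤ K x * p x) (x : EuclideanSpace ℝ (Fin d)) {σ : ℝ} (hσ : 0 < σ) :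
    ENNReal.ofReal ((Real.sqrt (p x) - Real.sqrt (∫ y, p (x - σ • y) * stdGauss d y)) ^ 2) ≤
      ENNReal.ofReal (σ * (d ^ 2 * σ ^ 2 / 4)) * ∫⁻ r in Set.Ioc 0 σ,
        ∫⁻ y, ENNReal.ofReal (K (x - r • y) * stdGauss d y) := by
  let G : ℝ → ℝ := fun r => ∫ y, p (x - r • y) * stdGauss d y
  let G' : ℝ → ℝ := fun r => ∫ y, -(fderiv ℝ p (x - r • y) y) * stdGauss d y
  have hG : ∀ r, HasDerivAt G (G' r) r := G_deriv d p hs B hB0 hB x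
  have hG'c : Continuous G' := G'_cont d p hs B hB x
  have hGc : Continuous G := continuous_iff_continuousAt.2 fun r => (hG r).continuousAt
  have hG0 : ∀ r, 0 ≤ G r := fun r =>
    integral_nonneg fun y => mul_nonneg (hp0 _) (sg_nonneg d y)
  have hGz : G 0 = p x := by
    simp only [G, zero_smul, sub_zero, integral_const_mul, sg_one, mul_one]
  let k : ℝ → ℝ := fun r => ∫ y, K (x - r • y) * stdGauss d y
  have hk0 : ∀ r, 0 ≤ k r := fun r =>
    integral_nonneg fun y => mul_nonneg (hK0 _) (sg_nonneg d y)
  have hbd : ∀ r, 0 < r → G' r ^ 2 ≤ d ^ 2 * r ^ 2 * (k r * G r) := by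
    intro r hr
    have h1 := G'_bound d p hs B hB hH x hr.ne'
    have h2 := cs d p _ K x hr.ne' hp hH hK hp0 hK0 h
    have h3 : |G' r| ^ 2 ≤ (d * (|r| * ∫ y, ‖fderiv ℝ (fderiv ℝ p) (x - r • y)‖ * stdGauss d y)) ^ 2 :=
      pow_le_pow_left₀ (abs_nonneg _) h1 2
    rw [sq_abs, mul_pow, mul_pow, sq_abs, ← mul_assoc] at h3
    exact h3.trans (mul_le_mul_of_nonneg_left h2 (by positivity))
  have main : ∀ ε : ℝ, 0 < ε →
      ENNReal.ofReal ((Real.sqrt (p x + ε) - Real.sqrt (G σ + ε)) ^ 2) ≤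
      ENNReal.ofReal (σ * (d ^ 2 * σ ^ 2 / 4)) * ∫⁻ r in Set.Ioc 0 σ,
        ∫⁻ y, ENNReal.ofReal (K (x - r • y) * stdGauss d y) := by
    intro ε hε
    have hpos : ∀ r, 0 < G r + ε := fun r => by linarith [hG0 r]
    let s' : ℝ → ℝ := fun r => G' r / (2 * Real.sqrt (G r + ε))
    have hs' : ∀ r, HasDerivAt (fun r => Real.sqrt (G r + ε)) (s' r) r := fun r =>
      ((hG r).add_const ε).sqrt (hpos r).ne'
    have hs'c : Continuous s' := by
      refine hG'c.div (by fun_prop) fun r => ?_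
      have := Real.sqrt_pos.2 (hpos r)
      positivity
    have ftc := intervalIntegral.integral_eq_sub_of_hasDerivAt (a := 0) (b := σ)
      (fun r _ => hs' r) (hs'c.intervalIntegrable _ _)
    have hsq : (Real.sqrt (p x + ε) - Real.sqrt (G σ + ε)) ^ 2 = (∫ r in (0:ℝ)..σ, s' r) ^ 2 := by
      rw [ftc, hGz]; ring
    rw [hsq]
    refine (ENNReal.ofReal_le_ofReal (jensen hs'c hσ)).trans ?_
    rw [ENNReal.ofReal_mul hσ.le, ENNReal.ofReal_mul hσ.le, mul_assoc]
    refine mul_le_mul_right ?_ _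
    have hi : IntegrableOn (fun r => s' r ^ 2) (Set.Ioc 0 σ) :=
      ((hs'c.pow 2).intervalIntegrable (μ := volume) 0 σ).1
    rw [intervalIntegral.integral_of_le hσ.le, ofReal_integral_eq_lintegral_ofReal
      hi (ae_of_all _ fun r => sq_nonneg _),
      ← lintegral_const_mul' _ _ ENNReal.ofReal_ne_top]
    refine setLIntegral_mono' measurableSet_Ioc fun r hr => ?_
    rw [← ofReal_integral_eq_lintegral_ofReal (int_comp_sg d hK x hr.1.ne')
      (ae_of_all _ fun y => mul_nonneg (hK0 _) (sg_nonneg d y)),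
      ← ENNReal.ofReal_mul (by positivity)]
    refine ENNReal.ofReal_le_ofReal ?_
    change s' r ^ 2 ≤ d ^ 2 * σ ^ 2 / 4 * k r
    simp only [s']
    rw [div_pow, mul_pow, Real.sq_sqrt (hpos r).le, div_le_iff₀ (by linarith [hpos r])]
    have h1 := hbd r hr.1
    have h2 : r ^ 2 ≤ σ ^ 2 := pow_le_pow_left₀ hr.1.le hr.2 2
    calc G' r ^ 2 ≤ d ^ 2 * r ^ 2 * (k r * G r) := h1
      _ ≤ d ^ 2 * σ ^ 2 * (k r * (G r + ε)) := by
        have := hk0 r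
        have := hG0 r
        gcongr
        linarith
      _ = _ := by ring
  have hlim : Filter.Tendsto (fun ε : ℝ =>
      ENNReal.ofReal ((Real.sqrt (p x + ε) - Real.sqrt (G σ + ε)) ^ 2)) (nhdsWithin 0 (Set.Ioi 0))
      (nhds (ENNReal.ofReal ((Real.sqrt (p x) - Real.sqrt (G σ)) ^ 2))) := by
    have hc : Continuous (fun ε : ℝ =>
      ENNReal.ofReal ((Real.sqrt (p x + ε) - Real.sqrt (G σ + ε)) ^ 2)) :=
      ENNReal.continuous_ofReal.comp (by fun_prop)
    have := (hc.tendsto 0).mono_left (nhdsWithin_le_nhds (s := Set.Ioi 0))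
    simpa using this
  exact le_of_tendsto hlim (eventually_mem_nhdsWithin.mono fun ε hε => main ε hε)

lemma triple (d : ℕ) (K : (EuclideanSpace ℝ (Fin d)) → ℝ) (hKm : Measurable K) (hK : Integrable K)
    (hK0 : ∀ x, 0 ≤ K x) {σ : ℝ} :
    ∫⁻ x, ∫⁻ r in Set.Ioc 0 σ, ∫⁻ y, ENNReal.ofReal (K (x - r • y) * stdGauss d y) =
      ENNReal.ofReal σ * ENNReal.ofReal (∫ x, K x) := by
  have hgm : Measurable (stdGauss d) := (sg_cont d).measurable
  have m3 : Measurable (fun q : ((EuclideanSpace ℝ (Fin d)) × ℝ) × (EuclideanSpace ℝ (Fin d)) =>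
      ENNReal.ofReal (K (q.1.1 - q.1.2 • q.2) * stdGauss d q.2)) := by fun_prop
  rw [lintegral_lintegral_swap]
  swap
  · exact (Measurable.lintegral_prod_right' m3).aemeasurable
  have h1 : ∀ r : ℝ, ∫⁻ x, ∫⁻ y, ENNReal.ofReal (K (x - r • y) * stdGauss d y) =
      ENNReal.ofReal (∫ x, K x) := by
    intro r
    rw [lintegral_lintegral_swap]
    swap
    · apply Measurable.aemeasurable
      unfold Function.uncurry
      fun_prop
    have h2 : ∀ y : EuclideanSpace ℝ (Fin d), ∫⁻ x, ENNReal.ofReal (K (x - r • y) * stdGauss d y) =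
        ENNReal.ofReal (∫ x, K x) * ENNReal.ofReal (stdGauss d y) := by
      intro y
      simp_rw [fun x => ENNReal.ofReal_mul (q := stdGauss d y) (hK0 x)]
      rw [lintegral_mul_const' _ _ ENNReal.ofReal_ne_top,
        lintegral_sub_right_eq_self (fun x => ENNReal.ofReal (K x)) (r • y),
        ofReal_integral_eq_lintegral_ofReal hK (ae_of_all _ hK0)]
    simp_rw [h2]
    rw [lintegral_const_mul' _ _ ENNReal.ofReal_ne_top, ← ofReal_integral_eq_lintegral_ofReal
      (sg_int d) (ae_of_all _ (sg_nonneg d)), sg_one]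
    simp
  simp_rw [h1]
  simp [mul_comm]

/-- Let `p₀` be a twice continuously differentiable probability density on `ℝ^d` with
`∫ (‖∇p₀‖/p₀)⁴ p₀ < ∞` and `∫ (‖∇²p₀‖₂/p₀)² p₀ < ∞`, and with `p₀` and `∇p₀` uniformly
bounded. Then the Gaussian-smoothed density `p_σ(x) = ∫ p₀(x - σ y) φ(y) dy` satisfies
`h(p₀, p_σ) ≤ C σ²` for a constant `C` depending only on `p₀` and `d`. -/
theorem hellinger_smoothing_bound (d : ℕ) (p₀ : EuclideanSpace ℝ (Fin d) → ℝ)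
    (hsmooth : ContDiff ℝ 2 p₀)
    (hp0 : ∀ x, 0 ≤ p₀ x) (hp1 : ∫ x, p₀ x = 1)
    (hbdd : ∃ B : ℝ, ∀ x, p₀ x ≤ B ∧ ‖fderiv ℝ p₀ x‖ ≤ B)
    (hmom1 : Integrable (fun x => (‖fderiv ℝ p₀ x‖ / p₀ x) ^ 4 * p₀ x))
    (hmom2 : Integrable (fun x => (‖fderiv ℝ (fderiv ℝ p₀) x‖ / p₀ x) ^ 2 * p₀ x)) :
    ∃ C > (0 : ℝ), ∀ σ : ℝ, 0 < σ →
      (∫ x, (Real.sqrt (p₀ x) -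
          Real.sqrt (∫ y, p₀ (x - σ • y) * stdGauss d y)) ^ 2) ^ (1 / 2 : ℝ) ≤
        C * σ ^ 2 := by
  obtain ⟨B, hB⟩ := hbdd
  have hp : Integrable p₀ := by
    by_contra hn
    rw [integral_undef hn] at hp1
    exact zero_ne_one hp1
  set K : EuclideanSpace ℝ (Fin d) → ℝ :=
    fun x => (‖fderiv ℝ (fderiv ℝ p₀) x‖ / p₀ x) ^ 2 * p₀ x with hKdef
  have hd1 : ContDiff ℝ 1 (fderiv ℝ p₀) := hsmooth.fderiv_right (m := 1) (by norm_num)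
  have hddc : Continuous (fderiv ℝ (fderiv ℝ p₀)) := hd1.continuous_fderiv (by norm_num)
  have hnc : Continuous (fun x => ‖fderiv ℝ (fderiv ℝ p₀) x‖) :=
    (continuous_norm (E := EuclideanSpace ℝ (Fin d) →L[ℝ] EuclideanSpace ℝ (Fin d) →L[ℝ] ℝ)).comp
      hddc
  have hKm : Measurable K := by
    have h1 := hnc.measurable
    have h2 := hsmooth.continuous.measurable
    exact ((h1.div h2).pow_const 2).mul h2
  have hK0 : ∀ x, 0 ≤ K x := fun x => mul_nonneg (sq_nonneg _) (hp0 x)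
  have hHK : ∀ᵐ x, ‖fderiv ℝ (fderiv ℝ p₀) x‖ ^ 2 ≤ K x * p₀ x := by
    filter_upwards [hess_zero d p₀ hsmooth hp0] with x hx
    by_cases h0 : p₀ x = 0
    · have hz : ‖fderiv ℝ (fderiv ℝ p₀) x‖ = 0 := by
        rw [hx h0]; exact ContinuousLinearMap.opNorm_zero
      rw [hz, h0]; simp
    · simp only [hKdef]
      apply le_of_eq
      field_simp
  have hH : Integrable (fun x => ‖fderiv ℝ (fderiv ℝ p₀) x‖) := by
    refine (hmom2.add hp).mono' hnc.aestronglyMeasurable ?_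
    filter_upwards [hHK] with x hx
    rw [Real.norm_eq_abs]
    change _ ≤ K x + p₀ x
    refine abs_le_of_sq_le_sq ?_ (add_nonneg (hK0 x) (hp0 x))
    nlinarith [hK0 x, hp0 x, mul_nonneg (hK0 x) (hp0 x)]
  have hI : 0 ≤ ∫ x, K x := integral_nonneg hK0
  refine ⟨d * Real.sqrt (∫ x, K x) / 2 + 1, by positivity, fun σ hσ => ?_⟩
  have hpw := fun x => pointwise d p₀ K hsmooth B
    (fun x => by rw [Real.norm_of_nonneg (hp0 x)]; exact (hB x).1) (fun x => (hB x).2) hH hp hmom2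
    hp0 hK0 hHK x hσ
  have hle : ∫⁻ x, ENNReal.ofReal ((Real.sqrt (p₀ x) -
      Real.sqrt (∫ y, p₀ (x - σ • y) * stdGauss d y)) ^ 2) ≤
      ENNReal.ofReal (σ * (d ^ 2 * σ ^ 2 / 4) * (σ * ∫ x, K x)) := by
    refine (lintegral_mono hpw).trans ?_
    rw [lintegral_const_mul' _ _ ENNReal.ofReal_ne_top, triple d K hKm hmom2 hK0,
      ← ENNReal.ofReal_mul hσ.le, ← ENNReal.ofReal_mul (by positivity)]
  have hle2 : ∫ x, (Real.sqrt (p₀ x) -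
      Real.sqrt (∫ y, p₀ (x - σ • y) * stdGauss d y)) ^ 2 ≤
      σ * (d ^ 2 * σ ^ 2 / 4) * (σ * ∫ x, K x) := by
    have h1 := enorm_integral_le_lintegral_enorm (μ := volume) (fun x => (Real.sqrt (p₀ x) -
      Real.sqrt (∫ y, p₀ (x - σ • y) * stdGauss d y)) ^ 2)
    rw [Real.enorm_of_nonneg (integral_nonneg fun x => sq_nonneg _)] at h1
    simp_rw [fun x => Real.enorm_of_nonneg (sq_nonneg (Real.sqrt (p₀ x) -
      Real.sqrt (∫ y, p₀ (x - σ • y) * stdGauss d y)))] at h1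
    exact (ENNReal.ofReal_le_ofReal_iff (by positivity)).1 (h1.trans hle)
  rw [← Real.sqrt_eq_rpow]
  refine (Real.sqrt_le_sqrt hle2).trans ?_
  have e : σ * (d ^ 2 * σ ^ 2 / 4) * (σ * ∫ x, K x) =
      (d * Real.sqrt (∫ x, K x) / 2 * σ ^ 2) ^ 2 := by
    have := Real.sq_sqrt hI
    rw [mul_pow, div_pow, mul_pow, this]; ring
  rw [e, Real.sqrt_sq (by positivity)]
  nlinarith [sq_nonneg σ]
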